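/- arXiv:2302.05539 — 5 statements merged into one kernel-verified Lean document; each statement's English description precedes it below -/
import Mathlib

section
/- Let ℋ be a stable ordered-union ultrafilter on FIN. Then for every A ∈ ℋ, every 1 ≤ n < ω and 1 ≤ k < ω, and every coloring c : A^[n] → k, there exists B ∈ ℋ with B ⊆ A such that c is constant on B^[n]. -/
open Set Filter

abbrev FIN : Type := {s : Finset ℕ // s.Nonempty}

def maxF (s : FIN) : ℕ := s.1.max' s.2

def minF (s : FIN) : ℕ := s.1.min' s.2

/-- `s <_b t` iff `max s < min t`. -/
def blt (s t : FIN) : Prop := maxF s < minF t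

/-- An infinite block sequence, presented as its increasing enumeration. -/
def IsBlockFun (X : ℕ → FIN) : Prop := ∀ i j : ℕ, i < j → blt (X i) (X j)

/-- A block sequence of length `n`. -/
def IsBlockSeqN {n : ℕ} (X : Fin n → FIN) : Prop :=
  ∀ i j : Fin n, i < j → blt (X i) (X j)

/-- `[X]` : all unions of finitely many (at least one) members of `X`. -/
def blocks (X : ℕ → FIN) : Set FIN :=
  {s | ∃ F : Finset ℕ, F.Nonempty ∧ s.1 = F.sup fun i => (X i).1}

def IsOrderedUnion (H : Ultrafilter FIN) : Prop :=
  ∀ A : Set FIN, A ∈ H →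
    ∃ X : ℕ → FIN, IsBlockFun X ∧ blocks X ∈ H ∧ blocks X ⊆ A

def IsStableOU (H : Ultrafilter FIN) : Prop :=
  IsOrderedUnion H ∧
    ∀ Xs : ℕ → ℕ → FIN, (∀ n, IsBlockFun (Xs n) ∧ blocks (Xs n) ∈ H) →
      ∃ Y : ℕ → FIN, IsBlockFun Y ∧ blocks Y ∈ H ∧
        ∀ n, ∀ᶠ i in atTop, Y i ∈ blocks (Xs n)

def IsSelective (U : Ultrafilter ℕ) : Prop :=
  ∀ f : ℕ → ℕ, ∃ A : Set ℕ, A ∈ U ∧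
    ((∀ x ∈ A, ∀ y ∈ A, f x = f y) ∨ Set.InjOn f A)

/-- `I(s) = {k : min s ≤ k ≤ max s}`. -/
def Iset (s : FIN) : Set ℕ := Set.Icc (minF s) (maxF s)

/-- `N(X) = ⋃ i, I(X(i))`. -/
def Nset (X : ℕ → FIN) : Set ℕ := ⋃ i, Iset (X i)

/-- Membership in the class `𝒞₀(ℋ)`. -/
def MemC0 (H : Ultrafilter FIN) (U : Ultrafilter ℕ) : Prop :=
  IsSelective U ∧
    ∀ X : ℕ → FIN, IsBlockFun X → blocks X ∈ H →
      ∃ Y : ℕ → FIN, IsBlockFun Y ∧ blocks Y ∈ H ∧ blocks Y ⊆ blocks X ∧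
        Nset Y ∉ U

def RKle (U V : Ultrafilter ℕ) : Prop := ∃ f : ℕ → ℕ, Ultrafilter.map f V = U

def RKequiv (U V : Ultrafilter ℕ) : Prop := RKle U V ∧ RKle V U

/-- Membership in the class `𝒞₁(ℋ)`. -/
def MemC1 (H : Ultrafilter FIN) (U : Ultrafilter ℕ) : Prop :=
  IsSelective U ∧
    ∀ V : Ultrafilter ℕ, IsSelective V → ¬ MemC0 H V → ¬ RKequiv U V

def initSeg {α : Type _} (f : ℕ → α) (n : ℕ) : List α := (List.range n).map f

def interleave (a : ℕ → ℕ) (b : ℕ → FIN) (m : ℕ) : ℕ ⊕ FIN :=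
  if m % 2 = 0 then Sum.inl (a (m / 2)) else Sum.inr (b (m / 2))

/-- Nodes of the tree `𝕋`: a node of length `l` is a sequence whose `k`-th entry
codes a function `𝒫(k) → 2` (coded as a total function `Finset ℕ → Bool`;
only values on subsets of `{0,…,k−1}` matter). -/
abbrev Node : Type := List (Finset ℕ → Bool)

/-- `s⁻ = s \ {max s}`. -/
def sm (s : FIN) : Finset ℕ := s.1.erase (maxF s)

/-- `A` is `(k,s)`-big. -/
def IsBig (k : ℕ) (s : FIN) (A : Set (Finset ℕ → Bool)) : Prop :=
  ∀ σ : Finset ℕ → Bool, ∃ τ ∈ A, ∀ u ⊆ Finset.range k, σ u = τ (u ∪ sm s)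

def succT (T : Set Node) (f : Node) : Set (Finset ℕ → Bool) := {τ | f ++ [τ] ∈ T}

/-- `H_{p,k}`. -/
def Hset (T : Set Node) (k : ℕ) : Set FIN :=
  {s | k ≤ maxF s ∧ ∀ f ∈ T, f.length = maxF s → IsBig k s (succT T f)}

/-- `T` is an `ℋ`-condition, i.e. a member of `ℙ(ℋ)`. -/
def IsCond (H : Ultrafilter FIN) (T : Set Node) : Prop :=
  (∀ g ∈ T, ∀ n, g.take n ∈ T) ∧ ([] : Node) ∈ T ∧
    (∀ f ∈ T, ∀ n : ℕ, f.length ≤ n → ∃ g ∈ T, f <+: g ∧ n ≤ g.length) ∧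
    ∀ k : ℕ, Hset T k ∈ H

/-- `T⟨f⟩`. -/
def Tsub (T : Set Node) (f : Node) : Set Node := {g ∈ T | f <+: g ∨ g <+: f}

/-- The constraint linking consecutive moves of Player I in `Γ^Cond(ℋ)`. -/
def StepOK (H : Ultrafilter FIN) (p : Set Node) (s : FIN) (p' : Set Node) : Prop :=
  ∃ q : Node → Set Node,
    (∀ e ∈ p, e.length = maxF s + 1 → IsCond H (q e) ∧ q e ⊆ Tsub p e) ∧
    p' = ⋃ e ∈ {e : Node | e ∈ p ∧ e.length = maxF s + 1}, q e


def Lg (g : ℕ → ℕ) (s : Finset ℕ) : Finset ℕ :=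
  s.filter fun b => ∀ x ∈ s, x < b → g x ≤ b

def unF (s t : FIN) : FIN := ⟨s.1 ∪ t.1, s.2.mono Finset.subset_union_left⟩

theorem mem_Lg (g : ℕ → ℕ) (s : Finset ℕ) (b : ℕ) :
    b ∈ Lg g s ↔ b ∈ s ∧ ∀ x ∈ s, x < b → g x ≤ b := Finset.mem_filter

theorem mem_unF (s t : FIN) (b : ℕ) : b ∈ (unF s t).1 ↔ b ∈ s.1 ∨ b ∈ t.1 := Finset.mem_union


theorem le_maxF (s : FIN) {x : ℕ} (h : x ∈ s.1) : x ≤ maxF s := Finset.le_max' _ _ h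
theorem minF_le (s : FIN) {x : ℕ} (h : x ∈ s.1) : minF s ≤ x := Finset.min'_le _ _ h
theorem maxF_mem (s : FIN) : maxF s ∈ s.1 := Finset.max'_mem _ _
theorem minF_mem (s : FIN) : minF s ∈ s.1 := Finset.min'_mem _ _
theorem minF_le_maxF (s : FIN) : minF s ≤ maxF s := le_maxF s (minF_mem s)

theorem Lg_large (g : ℕ → ℕ) (hg : Monotone g) (s t : FIN) (h : blt s t)
    (hl : g (maxF s) ≤ minF t) :
    (Lg g (unF s t).1).card = (Lg g s.1).card + (Lg g t.1).card := by
  have hlt : ∀ x ∈ s.1, ∀ y ∈ t.1, x < y := fun x hx y hy =>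
    lt_of_le_of_lt (le_maxF s hx) (lt_of_lt_of_le h (minF_le t hy))
  have hdis : Disjoint (Lg g s.1) (Lg g t.1) := by
    rw [Finset.disjoint_left]
    intro a ha hb
    exact lt_irrefl _ (hlt a (Finset.mem_filter.1 ha).1 a (Finset.mem_filter.1 hb).1)
  rw [← Finset.card_union_of_disjoint hdis]
  congr 1
  ext b
  simp only [mem_Lg, mem_unF, Finset.mem_union]
  constructor
  · rintro ⟨hb | hb, h2⟩
    · exact Or.inl ⟨hb, fun x hx => h2 x (Or.inl hx)⟩
    · exact Or.inr ⟨hb, fun x hx => h2 x (Or.inr hx)⟩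
  · rintro (⟨hb, h2⟩ | ⟨hb, h2⟩)
    · refine ⟨Or.inl hb, ?_⟩
      rintro x (hx | hx) hxb
      · exact h2 x hx hxb
      · exact absurd (hlt b hb x hx) (by omega)
    · refine ⟨Or.inr hb, ?_⟩
      rintro x (hx | hx) hxb
      · exact (hg (le_maxF s hx)).trans (hl.trans (minF_le t hb))
      · exact h2 x hx hxb

theorem Lg_small (g : ℕ → ℕ) (hg : Monotone g) (s t : FIN) (h : blt s t)
    (hl : minF t < g (maxF s)) :
    (Lg g (unF s t).1).card + 1 = (Lg g s.1).card + (Lg g t.1).card := by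
  have hlt : ∀ x ∈ s.1, ∀ y ∈ t.1, x < y := fun x hx y hy =>
    lt_of_le_of_lt (le_maxF s hx) (lt_of_lt_of_le h (minF_le t hy))
  have hdis : Disjoint (Lg g s.1) (Lg g t.1) := by
    rw [Finset.disjoint_left]
    intro a ha hb
    exact lt_irrefl _ (hlt a (Finset.mem_filter.1 ha).1 a (Finset.mem_filter.1 hb).1)
  rw [← Finset.card_union_of_disjoint hdis]
  have hnot : minF t ∉ Lg g (unF s t).1 := by
    intro hm
    have := (Finset.mem_filter.1 hm).2 (maxF s) (Finset.mem_union_left _ (maxF_mem s)) h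
    omega
  rw [← Finset.card_insert_of_notMem hnot]
  congr 1
  ext b
  simp only [mem_Lg, mem_unF, Finset.mem_union, Finset.mem_insert]
  constructor
  · rintro (rfl | ⟨hb | hb, h2⟩)
    · exact Or.inr ⟨minF_mem t, fun x hx hx2 => absurd (minF_le t hx) (by omega)⟩
    · exact Or.inl ⟨hb, fun x hx => h2 x (Or.inl hx)⟩
    · exact Or.inr ⟨hb, fun x hx => h2 x (Or.inr hx)⟩
  · rintro (⟨hb, h2⟩ | ⟨hb, h2⟩)
    · refine Or.inr ⟨Or.inl hb, ?_⟩
      rintro x (hx | hx) hxb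
      · exact h2 x hx hxb
      · exact absurd (hlt b hb x hx) (by omega)
    · by_cases hbm : b = minF t
      · exact Or.inl hbm
      have hlt2 : minF t < b := lt_of_le_of_ne (minF_le t hb) (Ne.symm hbm)
      refine Or.inr ⟨Or.inr hb, ?_⟩
      rintro x (hx | hx) hxb
      · exact (hg (hlt x hx _ (minF_mem t)).le).trans (h2 _ (minF_mem t) hlt2)
      · exact h2 x hx hxb

theorem unF_blocks (Z : ℕ → FIN) {s t : FIN} (hs : s ∈ blocks Z) (ht : t ∈ blocks Z) :
    unF s t ∈ blocks Z := by
  obtain ⟨F, hF, h1⟩ := hs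
  obtain ⟨G, hG, h2⟩ := ht
  refine ⟨F ∪ G, hF.mono Finset.subset_union_left, ?_⟩
  rw [Finset.sup_union, ← h1, ← h2]
  rfl

theorem mem_blocks (Z : ℕ → FIN) (i : ℕ) : Z i ∈ blocks Z :=
  ⟨{i}, Finset.singleton_nonempty i, by simp⟩

theorem le_minF (Z : ℕ → FIN) (hZ : IsBlockFun Z) (i : ℕ) : i ≤ minF (Z i) := by
  induction i with
  | zero => omega
  | succ i ih =>
    have h1 : maxF (Z i) < minF (Z (i+1)) := hZ i (i+1) (by omega)
    have h2 := minF_le_maxF (Z i)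
    omega

theorem gap_lemma (H : Ultrafilter FIN) (hH : IsOrderedUnion H) (g : ℕ → ℕ) (hg : Monotone g) :
    ∃ B ∈ H, ∀ s ∈ B, ∀ t ∈ B, blt s t → g (maxF s) ≤ minF t := by
  rcases H.mem_or_compl_mem {s | Even (Lg g s.1).card} with hE | hO
  · obtain ⟨Z, hZ, hZH, hZs⟩ := hH _ hE
    refine ⟨blocks Z, hZH, fun s hs t ht hst => ?_⟩
    by_contra hcon
    have := Lg_small g hg s t hst (not_le.1 hcon)
    have h1 : Even _ := hZs hs
    have h2 : Even _ := hZs ht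
    have h3 : Even _ := hZs (unF_blocks Z hs ht)
    rw [Nat.even_iff] at h1 h2 h3
    omega
  · obtain ⟨Z, hZ, hZH, hZs⟩ := hH _ hO
    exfalso
    have hst := hZ 0 (g (maxF (Z 0)) + 1) (by omega)
    have hl := le_minF Z hZ (g (maxF (Z 0)) + 1)
    have := Lg_large g hg _ _ hst (by omega)
    have h1 : ¬ Even _ := hZs (mem_blocks Z 0)
    have h2 : ¬ Even _ := hZs (mem_blocks Z (g (maxF (Z 0)) + 1))
    have h3 : ¬ Even _ := hZs (unF_blocks Z (mem_blocks Z 0) (mem_blocks Z (g (maxF (Z 0)) + 1)))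
    rw [Nat.even_iff] at h1 h2 h3
    omega

theorem finite_max_le (n : ℕ) : {s : FIN | maxF s ≤ n}.Finite := by
  apply Set.Finite.of_finite_image (f := Subtype.val) _ Subtype.val_injective.injOn
  apply (Finset.finite_toSet (Finset.range (n+1)).powerset).subset
  rintro _ ⟨s, hs, rfl⟩
  simp only [Finset.coe_powerset, Set.mem_preimage, Set.mem_powerset_iff, Finset.coe_subset]
  intro x hx
  have := le_maxF s hx
  have h2 : maxF s ≤ n := hs
  simp; omega

theorem blocks_closed (X Y : ℕ → FIN) (F : Finset ℕ) (hF : F.Nonempty)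
    (h : ∀ i ∈ F, Y i ∈ blocks X) (t : FIN) (ht : t.1 = F.sup fun i => (Y i).1) :
    t ∈ blocks X := by
  choose! G hG hG2 using h
  refine ⟨F.biUnion G, hF.biUnion hG, ?_⟩
  rw [ht, Finset.sup_biUnion]
  exact Finset.sup_congr rfl hG2

theorem diag (H : Ultrafilter FIN) (hH : IsStableOU H) (B : FIN → Set FIN) (hB : ∀ s, B s ∈ H) :
    ∃ C ∈ H, ∀ s ∈ C, ∀ t ∈ C, blt s t → t ∈ B s := by
  have hD : ∀ n, (⋂ s ∈ {s : FIN | maxF s ≤ n}, B s) ∈ H := fun n =>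
    (Filter.biInter_mem (finite_max_le n)).2 fun s _ => hB s
  choose Xs h1 h2 h3 using fun n => hH.1 _ (hD n)
  obtain ⟨Y, hY, hYH, hYX⟩ := hH.2 Xs fun n => ⟨h1 n, h2 n⟩
  choose N hN using fun n => Filter.eventually_atTop.1 (hYX n)
  let g : ℕ → ℕ := fun n => ∑ j ∈ Finset.range (n+1), minF (Y (N j))
  have hg : Monotone g := fun a b hab =>
    Finset.sum_le_sum_of_subset (Finset.range_mono (by omega))
  obtain ⟨C, hC, hCg⟩ := gap_lemma H hH.1 g hg
  refine ⟨C ∩ blocks Y, Filter.inter_mem hC hYH, fun s hs t ht hst => ?_⟩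
  have hgl := hCg s hs.1 t ht.1 hst
  obtain ⟨F, hF, hFt⟩ := ht.2
  have hgn : minF (Y (N (maxF s))) ≤ g (maxF s) :=
    Finset.single_le_sum (f := fun j => minF (Y (N j))) (fun _ _ => Nat.zero_le _)
      (Finset.mem_range.2 (Nat.lt_succ_self _))
  have : t ∈ blocks (Xs (maxF s)) := by
    apply blocks_closed _ Y F hF _ t hFt
    intro i hi
    apply hN
    by_contra hlt
    have hb : maxF (Y i) < minF (Y (N (maxF s))) := hY _ _ (not_le.1 hlt)
    have hsub : (Y i).1 ⊆ t.1 := by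
      rw [hFt]
      exact Finset.le_sup (f := fun i => (Y i).1) hi
    have := minF_le t (hsub (maxF_mem (Y i)))
    omega
  exact Set.mem_iInter₂.1 (h3 _ this) s (le_refl (maxF s))

theorem ramsey_aux (H : Ultrafilter FIN) (hH : IsStableOU H) (n k : ℕ) :
    ∀ c : (Fin n → FIN) → Fin k, ∃ B ∈ H, ∃ i : Fin k, ∀ X : Fin n → FIN,
      (∀ j, X j ∈ B) → IsBlockSeqN X → c X = i := by
  induction n with
  | zero =>
    intro c
    exact ⟨Set.univ, Filter.univ_mem, c Fin.elim0, fun X _ _ => by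
      congr 1; exact Subsingleton.elim _ _⟩
  | succ n ih =>
    intro c
    choose B hB i hi using fun s : FIN => ih fun X => c (Fin.cons s X)
    obtain ⟨e, he⟩ : ∃ e, {s | i s = e} ∈ H := by
      by_contra hcon
      push Not at hcon
      have h2 : ∀ e, {s | i s = e}ᶜ ∈ H := fun e => Ultrafilter.compl_mem_iff_notMem.2 (hcon e)
      have h3 := Filter.iInter_mem.2 h2
      obtain ⟨s, hs⟩ := H.nonempty_of_mem h3
      exact Set.mem_iInter.1 hs (i s) rfl
    obtain ⟨C, hC, hCB⟩ := diag H hH B hB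
    refine ⟨C ∩ {s | i s = e}, Filter.inter_mem hC he, e, fun X hX hXb => ?_⟩
    have h0 := hi (X 0) (Fin.tail X)
      (fun j => hCB _ (hX 0).1 _ (hX j.succ).1 (hXb 0 j.succ (Fin.succ_pos j)))
      (fun a b hab => hXb a.succ b.succ (Fin.succ_lt_succ_iff.2 hab))
    rw [Fin.cons_self_tail] at h0
    exact h0.trans (hX 0).2

/-- stable ordered-union ultrafilters have the Ramsey property for
finite colorings of block sequences of any fixed finite length, relative to any
member of the ultrafilter. -/
theorem stmt0 (H : Ultrafilter FIN) (hH : IsStableOU H)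
    (A : Set FIN) (hA : A ∈ H) (n k : ℕ) (hn : 1 ≤ n) (hk : 1 ≤ k)
    (c : (Fin n → FIN) → Fin k) :
    ∃ B : Set FIN, B ∈ H ∧ B ⊆ A ∧
      ∀ X Y : Fin n → FIN,
        (∀ i, X i ∈ B) → IsBlockSeqN X →
        (∀ i, Y i ∈ B) → IsBlockSeqN Y →
        c X = c Y := by
  obtain ⟨B, hB, e, he⟩ := ramsey_aux H hH n k c
  refine ⟨B ∩ A, Filter.inter_mem hB hA, Set.inter_subset_right, fun X Y hX hXb hY hYb => ?_⟩
  rw [he X (fun i => (hX i).1) hXb, he Y (fun i => (hY i).1) hYb]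
end

section
/- Let ℋ be a stable ordered-union ultrafilter on FIN and let (A_n)_{n∈ω} be a sequence with A_n ∈ ℋ for all n ∈ ω. Then there exists X ∈ FIN^[ω] such that [X] ∈ ℋ, [X] ⊆ A_0, and for every i ∈ ω, [{X(j) : j > i}] ⊆ A_{max(X(i))}. -/
open Set Filter

/-- Elements of `s` followed by a short gap. -/
def shG (g : ℕ → ℕ) (s : Finset ℕ) : Finset ℕ :=
  s.filter fun a => ∃ b ∈ s, a < b ∧ b ≤ g a

lemma shG_union (g : ℕ → ℕ) (s t : FIN) (h : blt s t) :
    (shG g (s.1 ∪ t.1)).card = (shG g s.1).card + (shG g t.1).card +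
      if minF t ≤ g (maxF s) then 1 else 0 := by
  have hs : ∀ a ∈ s.1, a ≤ maxF s := fun a ha => Finset.le_max' _ _ ha
  have ht : ∀ a ∈ t.1, minF t ≤ a := fun a ha => Finset.min'_le _ _ ha
  have hms : maxF s ∈ s.1 := Finset.max'_mem _ _
  have hmt : minF t ∈ t.1 := Finset.min'_mem _ _
  have h' : maxF s < minF t := h
  have hd1 : Disjoint (shG g s.1) (shG g t.1) := by
    rw [Finset.disjoint_left]
    intro a ha hb
    have h1 := hs a (Finset.mem_filter.1 ha).1
    have h2 := ht a (Finset.mem_filter.1 hb).1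
    omega
  have hd2 : Disjoint (shG g s.1 ∪ shG g t.1)
      (if minF t ≤ g (maxF s) then {maxF s} else ∅) := by
    split_ifs
    · rw [Finset.disjoint_singleton_right, Finset.mem_union]
      rintro (h1 | h1)
      · obtain ⟨_, b, hb, hb1, _⟩ := Finset.mem_filter.1 h1
        have := hs b hb
        omega
      · have := ht _ (Finset.mem_filter.1 h1).1
        omega
    · simp
  have key : shG g (s.1 ∪ t.1) = (shG g s.1 ∪ shG g t.1) ∪
      (if minF t ≤ g (maxF s) then {maxF s} else ∅) := by
    ext a
    have e : a ∈ (if minF t ≤ g (maxF s) then {maxF s} else (∅ : Finset ℕ)) ↔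
        minF t ≤ g (maxF s) ∧ a = maxF s := by
      split_ifs with hc <;> simp [hc]
    rw [Finset.mem_union, e, Finset.mem_union]
    simp only [shG, Finset.mem_filter, Finset.mem_union]
    constructor
    · rintro ⟨ha | ha, b, hb | hb, h1, h2⟩
      · exact Or.inl (Or.inl ⟨ha, b, hb, h1, h2⟩)
      · have h3 := hs a ha
        have h4 := ht b hb
        by_cases hm : a = maxF s
        · right
          subst hm
          exact ⟨by omega, rfl⟩
        · exact Or.inl (Or.inl ⟨ha, maxF s, hms, by omega, by omega⟩)
      · have h3 := ht a ha
        have h4 := hs b hb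
        omega
      · exact Or.inl (Or.inr ⟨ha, b, hb, h1, h2⟩)
    · rintro ((⟨ha, b, hb, h1, h2⟩ | ⟨ha, b, hb, h1, h2⟩) | ⟨h1, rfl⟩)
      · exact ⟨Or.inl ha, b, Or.inl hb, h1, h2⟩
      · exact ⟨Or.inr ha, b, Or.inr hb, h1, h2⟩
      · exact ⟨Or.inl hms, minF t, Or.inr hmt, h', h1⟩
  rw [key, Finset.card_union_of_disjoint hd2, Finset.card_union_of_disjoint hd1]
  split_ifs <;> simp

lemma mem_blocks_self (X : ℕ → FIN) (i : ℕ) : X i ∈ blocks X :=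
  ⟨{i}, by simp, by simp⟩

lemma union_mem_blocks (X : ℕ → FIN) (i j : ℕ) (h : ((X i).1 ∪ (X j).1).Nonempty) :
    (⟨(X i).1 ∪ (X j).1, h⟩ : FIN) ∈ blocks X :=
  ⟨{i, j}, by simp, by simp⟩

lemma blocks_sup (X Z : ℕ → FIN) (F : Finset ℕ) (hF : F.Nonempty) (s : FIN)
    (hs : s.1 = F.sup fun i => (Z i).1) (hZ : ∀ i ∈ F, Z i ∈ blocks X) : s ∈ blocks X := by
  have hZ' : ∀ i, ∃ G : Finset ℕ, i ∈ F →
      G.Nonempty ∧ (Z i).1 = G.sup fun i => (X i).1 := by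
    intro i
    by_cases hi : i ∈ F
    · obtain ⟨G, hG⟩ := hZ i hi
      exact ⟨G, fun _ => hG⟩
    · exact ⟨∅, fun h => absurd h hi⟩
  choose G hG using hZ'
  refine ⟨F.biUnion G, ?_, ?_⟩
  · obtain ⟨i, hi⟩ := hF
    obtain ⟨k, hk⟩ := (hG i hi).1
    exact ⟨k, Finset.mem_biUnion.2 ⟨i, hi, hk⟩⟩
  · rw [hs, Finset.sup_biUnion]
    exact Finset.sup_congr rfl fun i hi => (hG i hi).2

lemma le_minF_block (X : ℕ → FIN) (hX : IsBlockFun X) (n : ℕ) : n ≤ minF (X n) := by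
  induction n with
  | zero => exact Nat.zero_le _
  | succ n ih =>
    have h : maxF (X n) < minF (X (n+1)) := hX n (n+1) (Nat.lt_succ_self n)
    have h2 : minF (X n) ≤ maxF (X n) := Finset.min'_le _ _ (Finset.max'_mem _ _)
    omega

lemma gap_lemma_s1 (H : Ultrafilter FIN) (hH : IsOrderedUnion H) (B : Set FIN) (hB : B ∈ H)
    (g : ℕ → ℕ) : ∃ X : ℕ → FIN, IsBlockFun X ∧ blocks X ∈ H ∧ blocks X ⊆ B ∧
      ∀ i j, i < j → g (maxF (X i)) < minF (X j) := by
  let P : Set FIN := {s | Even (shG g s.1).card}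
  have hu : ∀ (X : ℕ → FIN) (i j : ℕ), ((X i).1 ∪ (X j).1).Nonempty := fun X i j =>
    (X i).2.mono Finset.subset_union_left
  rcases Ultrafilter.mem_or_compl_mem H P with hP | hP
  · obtain ⟨X, hX, hXH, hXs⟩ := hH (B ∩ P) (Filter.inter_mem hB hP)
    refine ⟨X, hX, hXH, fun s hs => (hXs hs).1, fun i j hij => ?_⟩
    by_contra hc
    have h1 : Even (shG g (X i).1).card := (hXs (mem_blocks_self X i)).2
    have h2 : Even (shG g (X j).1).card := (hXs (mem_blocks_self X j)).2
    have h3 : Even (shG g ((X i).1 ∪ (X j).1)).card := (hXs (union_mem_blocks X i j (hu X i j))).2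
    rw [shG_union g _ _ (hX i j hij), if_pos (not_lt.1 hc)] at h3
    rw [Nat.even_iff] at *
    omega
  · exfalso
    obtain ⟨X, hX, hXH, hXs⟩ := hH (Pᶜ) hP
    let j := g (maxF (X 0)) + 1
    have hj := le_minF_block X hX j
    have h1 : ¬ Even (shG g (X 0).1).card := hXs (mem_blocks_self X 0)
    have h2 : ¬ Even (shG g (X j).1).card := hXs (mem_blocks_self X j)
    have h3 : ¬ Even (shG g ((X 0).1 ∪ (X j).1)).card := hXs (union_mem_blocks X 0 j (hu X 0 j))
    rw [shG_union g _ _ (hX 0 j (Nat.succ_pos _)), if_neg (by omega)] at h3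
    rw [Nat.even_iff] at *
    omega

/-- diagonalization of a sequence of members of a stable
ordered-union ultrafilter. -/
theorem stmt1 (H : Ultrafilter FIN) (hH : IsStableOU H)
    (A : ℕ → Set FIN) (hA : ∀ n, A n ∈ H) :
    ∃ X : ℕ → FIN, IsBlockFun X ∧ blocks X ∈ H ∧ blocks X ⊆ A 0 ∧
      ∀ i : ℕ, blocks (fun j => X (i + 1 + j)) ⊆ A (maxF (X i)) := by
  obtain ⟨hO, hS⟩ := hH
  choose Xs hXb hXH hXA using fun n => hO (A n) (hA n)
  obtain ⟨Y, hY, hYH, hYX⟩ := hS Xs fun n => ⟨hXb n, hXH n⟩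
  choose f hf using fun n => eventually_atTop.1 (hYX n)
  obtain ⟨X, hX, hXm, hXs, hg⟩ := gap_lemma_s1 H hO (blocks Y ∩ A 0)
    (Filter.inter_mem hYH (hA 0)) (fun m => maxF (Y (f m)))
  refine ⟨X, hX, hXm, fun s hs => (hXs hs).2, fun i s hs => ?_⟩
  obtain ⟨F, hF, hs⟩ := hs
  apply hXA (maxF (X i))
  refine blocks_sup _ (fun j => X (i + 1 + j)) F hF s hs fun j _ => ?_
  obtain ⟨G, hG, hGe⟩ := (hXs (mem_blocks_self X (i + 1 + j))).1
  refine blocks_sup _ Y G hG _ hGe fun k hk => hf _ k ?_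
  by_contra hc
  have h1 : maxF (Y k) < minF (Y (f (maxF (X i)))) := hY _ _ (not_le.1 hc)
  have h2 : maxF (Y (f (maxF (X i)))) < minF (X (i + 1 + j)) := hg i (i + 1 + j) (by omega)
  have h3 : minF (Y k) ≤ maxF (Y k) := Finset.min'_le _ _ (Finset.max'_mem _ _)
  have h4 : minF (X (i + 1 + j)) ≤ minF (Y k) := by
    apply Finset.min'_le
    rw [hGe]
    have : (Y k).1 ≤ G.sup fun i => (Y i).1 := Finset.le_sup (f := fun i => (Y i).1) hk
    exact this (Finset.min'_mem _ _)
  have h5 : minF (Y (f (maxF (X i)))) ≤ maxF (Y (f (maxF (X i)))) :=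
    Finset.min'_le _ _ (Finset.max'_mem _ _)
  omega
end

section
/- If ℋ is a stable ordered-union ultrafilter on FIN, then for every Y ∈ FIN^[ω] with [Y] ∈ ℋ one has N(Y) ∈ ℋ_min and N(Y) ∈ ℋ_max; consequently ℋ_min ∉ 𝒞₀(ℋ) and ℋ_max ∉ 𝒞₀(ℋ). -/
open Set Filter

/-- for every `Y ∈ FIN^[ω]` with `[Y] ∈ ℋ`, `N(Y)` belongs to both
`ℋ_min` and `ℋ_max`; consequently `ℋ_min ∉ 𝒞₀(ℋ)` and `ℋ_max ∉ 𝒞₀(ℋ)`. -/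
theorem stmt2 (H : Ultrafilter FIN) (hH : IsStableOU H) :
    (∀ Y : ℕ → FIN, IsBlockFun Y → blocks Y ∈ H →
        Nset Y ∈ Ultrafilter.map minF H ∧ Nset Y ∈ Ultrafilter.map maxF H) ∧
      ¬ MemC0 H (Ultrafilter.map minF H) ∧ ¬ MemC0 H (Ultrafilter.map maxF H) := by
  have key : ∀ Y : ℕ → FIN, ∀ s ∈ blocks Y, ∀ x ∈ s.1, x ∈ Nset Y := by
    rintro Y s ⟨F, -, hs⟩ x hx
    rw [hs, Finset.mem_sup] at hx
    obtain ⟨i, -, hi⟩ := hx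
    exact Set.mem_iUnion.2 ⟨i, Finset.min'_le _ _ hi, Finset.le_max' _ _ hi⟩
  have h1 : ∀ Y : ℕ → FIN, IsBlockFun Y → blocks Y ∈ H →
        Nset Y ∈ Ultrafilter.map minF H ∧ Nset Y ∈ Ultrafilter.map maxF H := by
    intro Y _ hY
    rw [Ultrafilter.mem_map, Ultrafilter.mem_map]
    constructor
    · exact Filter.mem_of_superset hY fun s hs => key Y s hs _ (Finset.min'_mem _ _)
    · exact Filter.mem_of_superset hY fun s hs => key Y s hs _ (Finset.max'_mem _ _)
  obtain ⟨X, hX, hXH, -⟩ := hH.1 Set.univ Filter.univ_mem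
  refine ⟨h1, ?_, ?_⟩
  · rintro ⟨-, h⟩
    obtain ⟨Y, hY, hYH, -, hn⟩ := h X hX hXH
    exact hn (h1 Y hY hYH).1
  · rintro ⟨-, h⟩
    obtain ⟨Y, hY, hYH, -, hn⟩ := h X hX hXH
    exact hn (h1 Y hY hYH).2
end

section
/- Let ℋ be a stable ordered-union ultrafilter on FIN, p ∈ ℙ(ℋ), l ∈ ω, 1 ≤ m < ω, and e_1, …, e_m ∈ Lev_l(T_p). If p_1, …, p_m ∈ ℙ(ℋ) satisfy p_i ≤ T_p⟨e_i⟩ for every 1 ≤ i ≤ m, then the tree q with T_q = ⋃_{1≤i≤m} T_{p_i} is an ℋ-condition, p_i ≤ q for every 1 ≤ i ≤ m, and q ≤ p. -/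
open Set Filter

/-- amalgamation of conditions below the nodes of one level. -/
theorem stmt11 (H : Ultrafilter FIN) (hH : IsStableOU H)
    (T : Set Node) (hT : IsCond H T) (l m : ℕ) (hm : 1 ≤ m)
    (e : Fin m → Node) (he : ∀ i, e i ∈ T ∧ (e i).length = l)
    (P : Fin m → Set Node)
    (hP : ∀ i, IsCond H (P i) ∧ P i ⊆ Tsub T (e i)) :
    IsCond H (⋃ i, P i) ∧ (∀ i, P i ⊆ ⋃ i, P i) ∧ (⋃ i, P i) ⊆ T := by
  refine ⟨⟨?_, ?_, ?_, ?_⟩, fun i => subset_iUnion P i, ?_⟩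
  · intro g hg n
    obtain ⟨i, hi⟩ := mem_iUnion.1 hg
    exact mem_iUnion.2 ⟨i, (hP i).1.1 g hi n⟩
  · exact mem_iUnion.2 ⟨⟨0, hm⟩, (hP ⟨0, hm⟩).1.2.1⟩
  · intro f hf n hn
    obtain ⟨i, hi⟩ := mem_iUnion.1 hf
    obtain ⟨g, hg, h⟩ := (hP i).1.2.2.1 f hi n hn
    exact ⟨g, mem_iUnion.2 ⟨i, hg⟩, h⟩
  · intro k
    have h : (⋂ i, Hset (P i) k) ∈ (H : Filter FIN) :=
      Filter.iInter_mem.2 fun i => (hP i).1.2.2.2 k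
    refine Filter.mem_of_superset h ?_
    intro s hs
    rw [mem_iInter] at hs
    refine ⟨(hs ⟨0, hm⟩).1, ?_⟩
    intro f hf hl σ
    obtain ⟨i, hi⟩ := mem_iUnion.1 hf
    obtain ⟨τ, hτ, h2⟩ := (hs i).2 f hi hl σ
    exact ⟨τ, mem_iUnion.2 ⟨i, hτ⟩, h2⟩
  · exact iUnion_subset fun i g hg => ((hP i).2 hg).1
end

section
/- Let ℋ be a stable ordered-union ultrafilter on FIN and suppose ⟨((p_i, A_i), s_i) : i ∈ ω⟩ is a run of the ℋ-condition game Γ^Cond(ℋ) which is won by Player II. Let i ∈ ω and let q be the tree with T_q = ⋂_{j∈ω} T_{p_j}. If s_{i+1} ∈ H_{p_{i+1}, max(s_i)+1}, then s_{i+1} ∈ H_{q, max(s_i)+1}. -/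
open Set Filter

theorem step_sub {H : Ultrafilter FIN} {p p' : Set Node} {s : FIN}
    (h : StepOK H p s p') : p' ⊆ p := by
  obtain ⟨q, hq, rfl⟩ := h
  intro g hg
  simp only [Set.mem_iUnion] at hg
  obtain ⟨e, he, hg⟩ := hg
  exact ((hq e he.1 he.2).2 hg).1

theorem step_keep {H : Ultrafilter FIN} {p p' : Set Node} {s : FIN}
    (hp : IsCond H p) (hp' : IsCond H p')
    (h : StepOK H p s p') (g : Node) (hg : g ∈ p) (hl : g.length ≤ maxF s + 1) :
    g ∈ p' := by
  obtain ⟨g', hg', hpre, hlen⟩ := hp.2.2.1 g hg _ hl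
  have he : g'.take (maxF s + 1) ∈ p := hp.1 g' hg' _
  have hel : (g'.take (maxF s + 1)).length = maxF s + 1 := by
    rw [List.length_take]; omega
  have hge : g <+: g'.take (maxF s + 1) := List.prefix_take_iff.2 ⟨hpre, hl⟩
  obtain ⟨q, hq, rfl⟩ := h
  generalize g'.take (maxF s + 1) = e at *
  obtain ⟨hc, hsub⟩ := hq e he hel
  obtain ⟨x, hx, -, hxl⟩ := hc.2.2.1 [] hc.2.1 (maxF s + 1) (by simp)
  have hex : e <+: x := by
    rcases (hsub hx).2 with h1 | h1
    · exact h1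
    · have := h1.eq_of_length (by have := h1.length_le; omega)
      rw [this]
  have hgx := hge.trans hex
  have : g ∈ q e := by
    rw [List.prefix_iff_eq_take.1 hgx]
    exact hc.1 x hx _
  simp only [Set.mem_iUnion]
  exact ⟨e, ⟨he, hel⟩, this⟩

theorem maxF_mono {s : ℕ → FIN} (h : IsBlockFun s) : Monotone (fun j => maxF (s j)) := by
  refine monotone_nat_of_le_succ fun n => ?_
  have h1 : maxF (s n) < minF (s (n+1)) := h n (n+1) (Nat.lt_succ_self n)
  have h2 : minF (s (n+1)) ≤ maxF (s (n+1)) := Finset.min'_le_max' _ _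
  exact h1.le.trans h2

/-- in a run of `Γ^Cond(ℋ)` won by Player II, if
`s_{i+1} ∈ H_{p_{i+1}, max(s_i)+1}` then `s_{i+1} ∈ H_{q, max(s_i)+1}` where
`T_q = ⋂ j, T_{p_j}`. -/
theorem stmt15 (H : Ultrafilter FIN) (hH : IsStableOU H)
    (p : ℕ → Set Node) (A : ℕ → Set FIN) (s : ℕ → FIN)
    (hcond : ∀ i, IsCond H (p i)) (hA : ∀ i, A i ∈ H) (hs : ∀ i, s i ∈ A i)
    (hstep : ∀ i, StepOK H (p i) (s i) (p (i + 1)))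
    (hwin : IsBlockFun s ∧ blocks s ∈ H ∧ IsCond H (⋂ i, p i))
    (i : ℕ) (hmem : s (i + 1) ∈ Hset (p (i + 1)) (maxF (s i) + 1)) :
    s (i + 1) ∈ Hset (⋂ j, p j) (maxF (s i) + 1) := by
  refine ⟨hmem.1, fun f hf hfl σ => ?_⟩
  obtain ⟨τ, hτ, hu⟩ := hmem.2 f (Set.mem_iInter.1 hf (i + 1)) hfl σ
  refine ⟨τ, ?_, hu⟩
  have hanti : Antitone p := antitone_nat_of_succ_le fun n => step_sub (hstep n)
  have hτ' : f ++ [τ] ∈ p (i + 1) := hτ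
  have hup : ∀ j, i + 1 ≤ j → f ++ [τ] ∈ p j := by
    intro j hj
    induction j, hj using Nat.le_induction with
    | base => exact hτ'
    | succ j hj ih =>
      refine step_keep (hcond j) (hcond (j + 1)) (hstep j) _ ih ?_
      have : maxF (s (i + 1)) ≤ maxF (s j) := maxF_mono hwin.1 hj
      simp only [List.length_append, List.length_singleton]
      omega
  show f ++ [τ] ∈ ⋂ j, p j
  refine Set.mem_iInter.2 fun j => ?_
  rcases le_total (i + 1) j with h | h
  · exact hup j h
  · exact hanti h hτ'
end
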